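/- Suppose every utility function u_i is continuous, quasi-concave, and strictly increasing. Then for every α ∈ (0,1] there exists an α-slack equilibrium (x*, p*) such that x* is weakly 𝒞-constrained Pareto efficient. -/

import Mathlib

open Finset

noncomputable def dotO {O : Type*} [Fintype O] (p z : O → ℝ) : ℝ := ∑ l, p l * z l

noncomputable def dotIO {I O : Type*} [Fintype I] [Fintype O] (a x : I → O → ℝ) : ℝ :=
  ∑ i, ∑ l, a i l * x i l

noncomputable def pers {I O C : Type*} [Fintype C] (a : C → I → O → ℝ) (p : C → ℝ)
    (i : I) : O → ℝ :=
  fun l => ∑ c, a c i l * p c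


/-- A finite set `B` is dominant for the family of rankings `r` if no element lies strictly above
the minimum of `B` in all the rankings. -/
def IsDominant {U K : Type*} (r : K → U → ℕ) (B : Finset U) : Prop :=
  ∀ y, ∃ i, ∀ x ∈ B, r i y ≤ r i x

theorem IsDominant.mono {U K : Type*} {r : K → U → ℕ} {A B : Finset U} (hB : IsDominant r B)
    (h : A ⊆ B) : IsDominant r A := fun y =>
  let ⟨i, hi⟩ := hB y
  ⟨i, fun x hx => hi x (h hx)⟩

open Classical in
/-- Ordinal pivoting: a dominant set with one element less than the number of rankings extends in
exactly two ways to a dominant set with one more element. -/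
theorem card_dominant_insert_eq_two {U K : Type*} [Fintype U] [Fintype K]
    {r : K → U → ℕ} (hr : ∀ k, Function.Injective (r k)) {A : Finset U} (hAne : A.Nonempty)
    (hcard : A.card + 1 = Fintype.card K) (hA : IsDominant r A)
    (hY : ∀ i, ∃ y, ∀ k, k ≠ i → ∃ x ∈ A, r k x < r k y) :
    (univ.filter fun x => x ∉ A ∧ IsDominant r (insert x A)).card = 2 := by
  have hm : ∀ B : Finset U, B.Nonempty → ∃ m : K → U, ∀ k, m k ∈ B ∧ ∀ x ∈ B, r k (m k) ≤ r k x := by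
    intro B hB
    choose m hm using fun k => B.exists_min_image (r k) hB
    exact ⟨m, hm⟩
  obtain ⟨m, hm'⟩ := hm A hAne
  obtain ⟨i, -, j, -, hij, hmij⟩ : ∃ i ∈ (univ : Finset K), ∃ j ∈ (univ : Finset K), i ≠ j ∧ m i = m j :=
    exists_ne_map_eq_of_card_lt_of_maps_to (t := A) (by rw [card_univ]; omega)
      (fun k _ => (hm' k).1)
  have hmax : ∀ k, ∃ x, (∀ l, l ≠ k → r l (m l) < r l x) ∧
      ∀ y, (∀ l, l ≠ k → r l (m l) < r l y) → r k y ≤ r k x := by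
    intro k
    have hne : (univ.filter fun y => ∀ l, l ≠ k → r l (m l) < r l y).Nonempty := by
      obtain ⟨y, hy⟩ := hY k
      refine ⟨y, ?_⟩
      simp only [mem_filter, mem_univ, true_and]
      intro l hl
      obtain ⟨x, hx, hxy⟩ := hy l hl
      exact ((hm' l).2 x hx).trans_lt hxy
    obtain ⟨x, hx, hx'⟩ := exists_max_image _ (r k) hne
    simp only [mem_filter, mem_univ, true_and] at hx hx'
    exact ⟨x, hx, hx'⟩
  choose X hX hXmax using hmax
  have hdom : ∀ k x, (∀ l, l ≠ k → r l (m l) < r l x) → ∀ x' ∈ A, r k x ≤ r k x' := by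
    intro k x hx
    obtain ⟨l, hl⟩ := hA x
    by_cases hlk : l = k
    · exact hlk ▸ hl
    · exact absurd (hl _ (hm' l).1) (not_le.2 (hx l hlk))
  have hins : ∀ k k', k ≠ k' → m k = m k' → X k ∉ A ∧ IsDominant r (insert (X k) A) := by
    intro k k' hkk hmk
    constructor
    · intro hmem
      have h1 := hdom k (X k) (hX k) (m k) (hm' k).1
      have h2 : X k = m k := hr k (le_antisymm h1 ((hm' k).2 _ hmem))
      have h3 := hX k k' hkk.symm
      rw [h2, hmk] at h3
      exact lt_irrefl _ h3
    · intro y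
      by_cases hy : ∀ l, l ≠ k → r l (m l) < r l y
      · refine ⟨k, fun x hx => ?_⟩
        rcases mem_insert.1 hx with rfl | hx
        · exact hXmax k y hy
        · exact hdom k y hy x hx
      · push Not at hy
        obtain ⟨l, hl, hly⟩ := hy
        refine ⟨l, fun x hx => ?_⟩
        rcases mem_insert.1 hx with rfl | hx
        · exact hly.trans (hX k l hl).le
        · exact hly.trans ((hm' l).2 x hx)
  have hkey : (univ.filter fun x => x ∉ A ∧ IsDominant r (insert x A)) = {X i, X j} := by
    ext x
    simp only [mem_filter, mem_univ, true_and, mem_insert, mem_singleton]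
    constructor
    · rintro ⟨hxA, hx⟩
      obtain ⟨m', hm''⟩ := hm (insert x A) (insert_nonempty _ _)
      have himg : univ.image m' = insert x A := by
        ext z
        simp only [mem_image, mem_univ, true_and]
        constructor
        · rintro ⟨k, rfl⟩
          exact (hm'' k).1
        · intro hz
          obtain ⟨k, hk⟩ := hx z
          exact ⟨k, hr k (le_antisymm ((hm'' k).2 z hz) (hk _ (hm'' k).1))⟩
      have hinj : Function.Injective m' := by
        rw [← Set.injOn_univ, ← coe_univ, ← card_image_iff, himg, card_insert_of_notMem hxA, hcard,
          card_univ]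
      obtain ⟨k, hk⟩ : ∃ k, m' k = x := by
        have : x ∈ univ.image m' := himg ▸ mem_insert_self x A
        simpa using this
      have hne : ∀ l, l ≠ k → m' l = m l := by
        intro l hl
        have h1 : m' l ∈ A := (mem_insert.1 (hm'' l).1).resolve_left
          (fun h => hl (hinj (h.trans hk.symm)))
        exact hr l (le_antisymm ((hm'' l).2 _ (mem_insert_of_mem (hm' l).1)) ((hm' l).2 _ h1))
      have hxY : ∀ l, l ≠ k → r l (m l) < r l x := by
        intro l hl
        refine lt_of_le_of_ne ?_ ?_
        · rw [← hne l hl]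
          exact (hm'' l).2 x (mem_insert_self _ _)
        · intro h
          exact hxA (hr l h ▸ (hm' l).1)
      have hxX : x = X k := by
        refine hr k (le_antisymm (hXmax k x hxY) ?_)
        obtain ⟨l, hl⟩ := hx (X k)
        by_cases hlk : l = k
        · exact hlk ▸ hl x (mem_insert_self _ _)
        · exact absurd (hl _ (mem_insert_of_mem (hm' l).1)) (not_le.2 (hX k l hlk))
      by_cases hki : k = i
      · exact Or.inl (hki ▸ hxX)
      by_cases hkj : k = j
      · exact Or.inr (hkj ▸ hxX)
      exact absurd (hinj ((hne i (Ne.symm hki)).trans (hmij.trans (hne j (Ne.symm hkj)).symm))) hij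
    · rintro (rfl | rfl)
      · exact hins i j hij hmij
      · exact hins j i hij.symm hmij.symm
  rw [hkey, card_pair]
  intro h
  obtain ⟨l, hl⟩ := hA (X i)
  have hl' := hl _ (hm' l).1
  by_cases hli : l = i
  · have := hX j l (hli ▸ hij)
    rw [← h] at this
    omega
  · have := hX i l hli
    omega

open Classical in
/-- The boundary case of ordinal pivoting: all slack elements but one extend in exactly one way to
a dominant set with one more element. -/
theorem card_dominant_insert_slack_eq_one {U K : Type*} [Fintype U] [Fintype K]
    {r : K → U → ℕ} (hr : ∀ k, Function.Injective (r k)) {s : K → U}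
    (hs : ∀ k u, u ≠ s k → r k (s k) < r k u)
    (hst : ∀ k i t, t ∉ Set.range s → i ≠ k → r k t < r k (s i))
    (hne : ∃ t, t ∉ Set.range s) (i₀ : K) :
    (univ.filter fun x => x ∉ (univ.erase i₀).image s ∧
      IsDominant r (insert x ((univ.erase i₀).image s))).card = 1 := by
  have hnes : (univ.filter fun t => t ∉ Set.range s).Nonempty := by
    obtain ⟨t, ht⟩ := hne
    exact ⟨t, by simpa using ht⟩
  obtain ⟨t, ht, htmax⟩ := exists_max_image _ (r i₀) hnes
  simp only [mem_filter, mem_univ, true_and] at ht htmax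
  rw [card_eq_one]
  refine ⟨t, ?_⟩
  ext x
  simp only [mem_filter, mem_univ, true_and, mem_singleton]
  constructor
  · rintro ⟨hxA, hx⟩
    have hxs : x ∉ Set.range s := by
      rintro ⟨k, rfl⟩
      have hk : k = i₀ := by
        by_contra hk
        exact hxA (mem_image_of_mem _ (by simpa using hk))
      subst hk
      obtain ⟨l, hl⟩ := hx t
      have : s l ∈ insert (s k) ((univ.erase k).image s) := by
        by_cases hlk : l = k
        · simp [hlk]
        · exact mem_insert_of_mem (mem_image_of_mem _ (by simpa using hlk))
      exact absurd (hl _ this) (not_le.2 (hs l t fun h => ht ⟨l, h.symm⟩))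
    refine hr i₀ (le_antisymm (htmax x hxs) ?_)
    obtain ⟨l, hl⟩ := hx t
    by_cases hli : l = i₀
    · exact hli ▸ hl x (mem_insert_self _ _)
    · exact absurd (hl (s l) (mem_insert_of_mem (mem_image_of_mem _ (by simpa using hli))))
        (not_le.2 (hs l t fun h => ht ⟨l, h.symm⟩))
  · rintro rfl
    constructor
    · intro h
      obtain ⟨k, -, hk⟩ := mem_image.1 h
      exact ht ⟨k, hk⟩
    · intro y
      by_cases hy : y ∈ Set.range s
      · obtain ⟨l, rfl⟩ := hy
        refine ⟨l, fun z _ => ?_⟩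
        by_cases hz : z = s l
        · rw [hz]
        · exact (hs l z hz).le
      · refine ⟨i₀, fun z hz => ?_⟩
        rcases mem_insert.1 hz with rfl | hz
        · exact htmax y hy
        · obtain ⟨k, hk, rfl⟩ := mem_image.1 hz
          exact (hst i₀ k y hy (by simpa using hk)).le

open Classical in
/-- Among the sets obtained from a non-rainbow set `B` of size `card K` by deleting a point, an even
number carries exactly the colors other than `i₀`. -/
theorem even_card_almost_rainbow_subsets {U K : Type*} [Fintype U] [Fintype K]
    (c : U → K) (i₀ : K) {B : Finset U} (hB : B.card = Fintype.card K) (hc : B.image c ≠ univ) :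
    Even (univ.filter fun A : Finset U =>
      (A.card + 1 = Fintype.card K ∧ A.image c = univ.erase i₀) ∧ A ⊆ B).card := by
  set F := univ.filter fun A : Finset U =>
      (A.card + 1 = Fintype.card K ∧ A.image c = univ.erase i₀) ∧ A ⊆ B with hF
  rcases F.eq_empty_or_nonempty with h | ⟨A, hA⟩
  · simp [h]
  have hmem : ∀ A, A ∈ F ↔ (A.card + 1 = Fintype.card K ∧ A.image c = univ.erase i₀) ∧ A ⊆ B := by
    simp [hF]
  have herase : ∀ A ∈ F, ∃ z ∈ B, z ∉ A ∧ A = B.erase z := by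
    intro A hA
    obtain ⟨⟨h1, -⟩, h3⟩ := (hmem A).1 hA
    have : (B \ A).card = 1 := by rw [card_sdiff_of_subset h3]; omega
    obtain ⟨z, hz⟩ := card_eq_one.1 this
    have hzBA : z ∈ B \ A := hz ▸ mem_singleton_self z
    rw [mem_sdiff] at hzBA
    refine ⟨z, hzBA.1, hzBA.2, eq_of_subset_of_card_le ?_ ?_⟩
    · intro w hw
      exact mem_erase.2 ⟨fun h => hzBA.2 (h ▸ hw), h3 hw⟩
    · rw [card_erase_of_mem hzBA.1]; omega
  obtain ⟨x, hxB, hxA, hAx⟩ := herase A hA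
  obtain ⟨⟨hA1, hA2⟩, hA3⟩ := (hmem A).1 hA
  have hinj : Set.InjOn c A := by
    rw [← card_image_iff, hA2, card_erase_of_mem (mem_univ _), card_univ]; omega
  have hBins : B = insert x A := by rw [hAx, insert_erase hxB]
  have hcx : c x ≠ i₀ := by
    intro h
    apply hc
    rw [hBins, image_insert, hA2, h, insert_erase (mem_univ _)]
  obtain ⟨x', hx'A, hx'⟩ : ∃ x' ∈ A, c x' = c x := by
    have : c x ∈ A.image c := by rw [hA2]; simpa using hcx
    simpa using this
  have hx'x : x' ≠ x := fun h => hxA (h ▸ hx'A)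
  have hFeq : F = {A, B.erase x'} := by
    ext A'
    simp only [mem_insert, mem_singleton]
    constructor
    · intro hA'
      obtain ⟨z, hzB, hzA', hz⟩ := herase A' hA'
      by_cases hzx : z = x
      · left; rw [hz, hAx, hzx]
      right
      have hzA : z ∈ A := by rw [hAx]; exact mem_erase.2 ⟨hzx, hzB⟩
      have : c z ∈ A'.image c := by
        rw [((hmem A').1 hA').1.2, ← hA2]; exact mem_image_of_mem _ hzA
      obtain ⟨w, hw, hwz⟩ := mem_image.1 this
      have hwne : w ≠ z := fun h => hzA' (h ▸ hw)
      have hwx : w = x := by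
        by_contra hwx
        have : w ∈ A := by rw [hAx]; exact mem_erase.2 ⟨hwx, ((hmem A').1 hA').2 hw⟩
        exact hwne (hinj this hzA hwz)
      rw [hwx] at hwz
      rw [hz, hinj hzA hx'A (hwz.symm.trans hx'.symm)]
    · rintro (rfl | rfl)
      · exact hA
      · refine (hmem _).2 ⟨⟨?_, ?_⟩, erase_subset _ _⟩
        · rw [card_erase_of_mem (hA3 hx'A)]
          have : 0 < B.card := card_pos.2 ⟨x, hxB⟩
          omega
        · rw [← hA2]
          ext k
          simp only [mem_image, mem_erase]
          constructor
          · rintro ⟨w, ⟨hw1, hw2⟩, rfl⟩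
            rw [hBins, mem_insert] at hw2
            rcases hw2 with rfl | hw2
            · exact ⟨x', hx'A, hx'⟩
            · exact ⟨w, hw2, rfl⟩
          · rintro ⟨w, hw, rfl⟩
            by_cases hwx : w = x'
            · exact ⟨x, ⟨hx'x.symm, hxB⟩, by rw [hwx, hx']⟩
            · exact ⟨w, ⟨hwx, hA3 hw⟩, rfl⟩
  rw [hFeq, card_pair]
  · exact even_two
  · intro h
    have : x' ∈ B.erase x' := h ▸ hx'A
    simp at this

open Classical in
/-- **Scarf's lemma** for integer labels. -/
theorem exists_dominant_rainbow {U K : Type*} [Fintype U] [Fintype K] [Nonempty K]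
    {r : K → U → ℕ} (hr : ∀ k, Function.Injective (r k)) {s : K → U}
    (hs : ∀ k u, u ≠ s k → r k (s k) < r k u)
    (hst : ∀ k i t, t ∉ Set.range s → i ≠ k → r k t < r k (s i))
    (hne : ∃ t, t ∉ Set.range s) {c : U → K} (hc : ∀ k, c (s k) = k) :
    ∃ B : Finset U, IsDominant r B ∧ B.image c = univ := by
  by_contra! hcon
  obtain ⟨i₀⟩ := ‹Nonempty K›
  have hpos : 0 < Fintype.card K := Fintype.card_pos_iff.2 ⟨i₀⟩
  set D := univ.filter fun A : Finset U =>
    A.card + 1 = Fintype.card K ∧ A.image c = univ.erase i₀ with hD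
  set R := univ.filter fun B : Finset U => B.card = Fintype.card K ∧ IsDominant r B with hR
  have hcount := sum_card_bipartiteAbove_eq_sum_card_bipartiteBelow (s := D) (t := R)
    (fun A B => A ⊆ B)
  have heven : Even (∑ B ∈ R, (D.bipartiteBelow (fun A B => A ⊆ B) B).card) := by
    refine even_sum _ fun B hB => ?_
    simp only [hR, mem_filter, mem_univ, true_and] at hB
    rw [bipartiteBelow, hD, filter_filter]
    exact even_card_almost_rainbow_subsets c i₀ hB.1 (hcon B hB.2)
  have habove : ∀ A ∈ D, (R.bipartiteAbove (fun A B => A ⊆ B) A).card =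
      (univ.filter fun x => x ∉ A ∧ IsDominant r (insert x A)).card := by
    intro A hA
    simp only [hD, mem_filter, mem_univ, true_and] at hA
    rw [eq_comm]
    refine card_bij (fun x _ => insert x A) ?_ ?_ ?_
    · intro x hx
      simp only [mem_filter, mem_univ, true_and] at hx
      simp only [bipartiteAbove, hR, mem_filter, mem_univ, true_and]
      exact ⟨⟨by rw [card_insert_of_notMem hx.1, hA.1], hx.2⟩, subset_insert _ _⟩
    · intro x hx y hy hxy
      simp only [mem_filter, mem_univ, true_and] at hx hy
      have : x ∈ insert y A := hxy ▸ mem_insert_self x A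
      exact (mem_insert.1 this).resolve_right hx.1
    · intro B hB
      simp only [bipartiteAbove, hR, mem_filter, mem_univ, true_and] at hB
      have : (B \ A).card = 1 := by rw [card_sdiff_of_subset hB.2]; omega
      obtain ⟨x, hx⟩ := card_eq_one.1 this
      have hxB : x ∈ B \ A := hx ▸ mem_singleton_self x
      have hBA : insert x A = B := by
        rw [← sdiff_union_of_subset hB.2, hx]; rfl
      refine ⟨x, ?_, hBA⟩
      simp only [mem_filter, mem_univ, true_and]
      exact ⟨(mem_sdiff.1 hxB).2, hBA ▸ hB.1.2⟩
  have hsinj : Function.Injective s := fun k l h => by rw [← hc k, h, hc]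
  have hA₀ : (univ.erase i₀).image s ∈ D := by
    simp only [hD, mem_filter, mem_univ, true_and]
    constructor
    · rw [card_image_of_injective _ hsinj, card_erase_of_mem (mem_univ _), card_univ]; omega
    · rw [image_image]
      have : c ∘ s = id := funext hc
      rw [this, image_id]
  rw [← hcount, ← add_sum_erase _ _ hA₀, habove _ hA₀,
    card_dominant_insert_slack_eq_one hr hs hst hne i₀] at heven
  have hrest : Even (∑ A ∈ D.erase ((univ.erase i₀).image s),
      (R.bipartiteAbove (fun A B => A ⊆ B) A).card) := by
    refine even_sum _ fun A hA => ?_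
    obtain ⟨hA1, hA⟩ := mem_erase.1 hA
    rw [habove A hA]
    simp only [hD, mem_filter, mem_univ, true_and] at hA
    obtain ⟨t, htA, ht⟩ : ∃ t ∈ A, t ∉ Set.range s := by
      by_contra! hsub
      apply hA1
      rw [← hA.2, image_image]
      ext z
      simp only [mem_image, Function.comp]
      constructor
      · intro hz
        obtain ⟨k, rfl⟩ := hsub z hz
        exact ⟨s k, hz, by rw [hc]⟩
      · rintro ⟨w, hw, rfl⟩
        obtain ⟨k, rfl⟩ := hsub w hw
        rwa [hc]
    by_cases hdom : IsDominant r A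
    · rw [card_dominant_insert_eq_two hr ⟨t, htA⟩ hA.1 hdom]
      · exact even_two
      · exact fun i => ⟨s i, fun k hk => ⟨t, htA, hst k i t ht hk.symm⟩⟩
    · rw [filter_false_of_mem]
      · simp
      · exact fun x _ h => hdom (h.2.mono (subset_insert _ _))
  rw [Nat.even_add] at heven
  exact absurd (heven.2 hrest) (by decide)

open Classical in
/-- Any labelling of the integer grid points of a dilated simplex admits a grid point that, for each
label `k`, either has a small `k`-th coordinate or is close to a grid point labelled `k`. -/
theorem exists_grid_point_near_labels {K : Type*} [Fintype K] [Nonempty K] (N : ℕ)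
    (c : (K → ℕ) → K) :
    ∃ t : K → ℕ, ∑ k, t k = N ∧ ∀ k, t k ≤ Fintype.card K ∨
      ∃ t' : K → ℕ, ∑ k, t' k = N ∧ c t' = k ∧
        ∀ j, t' j ≤ t j + Fintype.card K ∧ t j ≤ t' j + Fintype.card K := by
  let T := {t : K → ℕ // t ∈ piAntidiag (univ : Finset K) N}
  have hT : ∀ t : T, ∑ k, t.1 k = N := fun t => (mem_piAntidiag.1 t.2).1
  let U := T ⊕ K
  let f : K → U → ℕ := fun k => Sum.elim (fun t => t.1 k + 1) (fun i => if i = k then 0 else N + 2)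
  let r : K → U → ℕ := fun k u => f k u * Fintype.card U + (Fintype.equivFin U u : ℕ)
  have hlt : ∀ k u v, f k u < f k v → r k u < r k v := by
    intro k u v h
    have h1 : (Fintype.equivFin U u : ℕ) < Fintype.card U := (Fintype.equivFin U u).2
    have h2 : (f k u + 1) * Fintype.card U ≤ f k v * Fintype.card U := Nat.mul_le_mul_right _ h
    simp only [r]
    rw [add_mul] at h2
    omega
  have hr : ∀ k, Function.Injective (r k) := by
    intro k u v h
    have hf : f k u = f k v := by
      rcases lt_trichotomy (f k u) (f k v) with h' | h' | h'
      · exact absurd h (hlt k u v h').ne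
      · exact h'
      · exact absurd h (hlt k v u h').ne'
    simp only [r, hf, add_right_inj] at h
    exact (Fintype.equivFin U).injective (Fin.ext h)
  have hle : ∀ (t : T) k, t.1 k ≤ N := by
    intro t k
    exact (single_le_sum (f := t.1) (fun _ _ => Nat.zero_le _) (mem_univ k)).trans (hT t).le
  obtain ⟨k₀⟩ := ‹Nonempty K›
  have t₀ : T := ⟨fun k => if k = k₀ then N else 0, by
    rw [mem_piAntidiag]; exact ⟨by simp, fun _ _ => mem_univ _⟩⟩
  have : Nonempty K := ⟨k₀⟩
  obtain ⟨B, hB, hBc⟩ := exists_dominant_rainbow (r := r) (s := (Sum.inr : K → U)) hr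
    (by
      rintro k (t | i) hu
      · exact hlt _ _ _ (by simp [f])
      · exact hlt _ _ _ (by
          have : i ≠ k := fun h => hu (by rw [h])
          simp [f, this]))
    (by
      rintro k i (t | j) ht hik
      · refine hlt _ _ _ ?_
        have := hle t k
        simp only [f, Sum.elim_inl, Sum.elim_inr, if_neg hik]
        omega
      · exact absurd ⟨j, rfl⟩ ht)
    ⟨Sum.inl t₀, by simp⟩ (c := Sum.elim (fun t => c t.1) id) (fun k => rfl)
  obtain ⟨t, ht⟩ : ∃ t : T, (Sum.inl t : U) ∈ B := by
    by_contra! hno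
    obtain ⟨i, hi⟩ := hB (Sum.inl t₀)
    have hiB : (Sum.inr i : U) ∈ B := by
      have : i ∈ B.image (Sum.elim (fun t : T => c t.1) id) := by rw [hBc]; exact mem_univ i
      obtain ⟨u, hu, hui⟩ := mem_image.1 this
      rcases u with t | j
      · exact absurd hu (hno t)
      · simp only [Sum.elim_inr, id] at hui
        exact hui ▸ hu
    exact absurd (hi _ hiB) (not_le.2 (hlt _ _ _ (by simp [f])))
  have hmin : ∀ k, ∃ t : T, (Sum.inl t : U) ∈ B ∧ ∀ t' : T, (Sum.inl t' : U) ∈ B → t.1 k ≤ t'.1 k := by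
    intro k
    obtain ⟨x, hx, hx'⟩ := exists_min_image (univ.filter fun t : T => (Sum.inl t : U) ∈ B)
      (fun t => t.1 k) ⟨t, by simpa using ht⟩
    simp only [mem_filter, mem_univ, true_and] at hx hx'
    exact ⟨x, hx, hx'⟩
  choose μ hμB hμ using hmin
  set C := univ.filter fun k : K => (Sum.inr k : U) ∉ B with hC
  have hsum : N < ∑ k ∈ C, ((μ k).1 k + 1) := by
    by_contra! hcon
    let y : K → ℕ := fun k => (if k ∈ C then (μ k).1 k + 1 else 0) +
      if k = k₀ then N - ∑ k ∈ C, ((μ k).1 k + 1) else 0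
    have hy : y ∈ piAntidiag (univ : Finset K) N := by
      rw [mem_piAntidiag]
      refine ⟨?_, fun _ _ => mem_univ _⟩
      simp only [y]
      rw [sum_add_distrib, sum_ite_mem, univ_inter, sum_ite_eq' univ k₀, if_pos (mem_univ _)]
      omega
    obtain ⟨i, hi⟩ := hB (Sum.inl ⟨y, hy⟩)
    by_cases hiB : (Sum.inr i : U) ∈ B
    · exact absurd (hi _ hiB) (not_le.2 (hlt _ _ _ (by simp [f])))
    · refine absurd (hi _ (hμB i)) (not_le.2 (hlt _ _ _ ?_))
      have : i ∈ C := by simpa [hC] using hiB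
      simp only [f, Sum.elim_inl, y, if_pos this]
      omega
  have hCcard : C.card ≤ Fintype.card K := card_le_univ C
  rw [sum_add_distrib, sum_const, smul_eq_mul, mul_one] at hsum
  have hmem : ∀ t : T, (Sum.inl t : U) ∈ B → ∀ k ∈ C, t.1 k ≤ (μ k).1 k + Fintype.card K := by
    intro t ht k hk
    have h1 : ∑ k ∈ C, t.1 k ≤ N := (sum_le_univ_sum_of_nonneg fun _ => Nat.zero_le _).trans (hT t).le
    have h2 : ∑ k ∈ C.erase k, (μ k).1 k ≤ ∑ k ∈ C.erase k, t.1 k :=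
      sum_le_sum fun k _ => hμ k t ht
    have h3 := add_sum_erase C (fun k => (μ k).1 k) hk
    have h4 := add_sum_erase C (fun k => t.1 k) hk
    omega
  have hnmem : ∀ t : T, (Sum.inl t : U) ∈ B → ∀ k ∉ C, t.1 k ≤ Fintype.card K := by
    intro t ht k hk
    have h1 : ∑ k ∈ insert k C, t.1 k ≤ N :=
      (sum_le_univ_sum_of_nonneg fun _ => Nat.zero_le _).trans (hT t).le
    rw [sum_insert hk] at h1
    have h2 : ∑ k ∈ C, (μ k).1 k ≤ ∑ k ∈ C, t.1 k := sum_le_sum fun k _ => hμ k t ht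
    omega
  have hclose : ∀ t t' : T, (Sum.inl t : U) ∈ B → (Sum.inl t' : U) ∈ B →
      ∀ j, t.1 j ≤ t'.1 j + Fintype.card K := by
    intro t t' ht ht' j
    by_cases hj : j ∈ C
    · have := hmem t ht j hj
      have := hμ j t' ht'
      omega
    · have := hnmem t ht j hj
      omega
  refine ⟨t.1, hT t, fun k => ?_⟩
  by_cases hk : k ∈ C
  · right
    have : k ∈ B.image (Sum.elim (fun t : T => c t.1) id) := by rw [hBc]; exact mem_univ k
    obtain ⟨u, hu, huk⟩ := mem_image.1 this
    rcases u with t' | j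
    · exact ⟨t'.1, hT t', huk, fun j => ⟨hclose t' t hu ht j, hclose t t' ht hu j⟩⟩
    · simp only [Sum.elim_inr, id] at huk
      subst huk
      simp only [hC, mem_filter, mem_univ, true_and] at hk
      exact absurd hu hk
  · exact Or.inl (hnmem t ht k hk)

open Filter Topology in
/-- A dual form of the Knaster-Kuratowski-Mazurkiewicz lemma: a closed cover of the standard simplex
indexed by its vertices admits a point that lies in every member of the cover indexed by the
support of the point. -/
theorem exists_mem_of_stdSimplex_subset_iUnion {K : Type*} [Fintype K] [Nonempty K]
    {F : K → Set (K → ℝ)} (hF : ∀ k, IsClosed (F k)) (hcover : stdSimplex ℝ K ⊆ ⋃ k, F k) :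
    ∃ π ∈ stdSimplex ℝ K, ∀ k, 0 < π k → π ∈ F k := by
  classical
  have hcov : ∀ π : K → ℝ, ∃ k, π ∈ stdSimplex ℝ K → π ∈ F k := by
    intro π
    by_cases h : π ∈ stdSimplex ℝ K
    · obtain ⟨k, hk⟩ := Set.mem_iUnion.1 (hcover h)
      exact ⟨k, fun _ => hk⟩
    · exact ⟨Classical.arbitrary K, fun h' => absurd h' h⟩
  choose col hcol using hcov
  let sc : ℕ → (K → ℕ) → K → ℝ := fun n t k => (t k : ℝ) / (n + 1 : ℝ)
  have hsc : ∀ n t, ∑ k, t k = n + 1 → sc n t ∈ stdSimplex ℝ K := by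
    intro n t ht
    refine ⟨fun k => by positivity, ?_⟩
    simp only [sc]
    rw [← sum_div, ← Nat.cast_sum, ht]
    push_cast
    exact div_self (by positivity)
  have hgrid := fun n : ℕ => exists_grid_point_near_labels (K := K) (n + 1) (fun t => col (sc n t))
  choose t htsum ht using hgrid
  obtain ⟨π, hπ, φ, hφ, hlim⟩ := (isCompact_stdSimplex ℝ K).tendsto_subseq
    (fun n => hsc n (t n) (htsum n))
  have hsmall : Tendsto (fun n => (Fintype.card K : ℝ) / ((φ n : ℝ) + 1)) atTop (𝓝 0) :=
    (tendsto_const_div_atTop_nhds_zero_nat (Fintype.card K : ℝ)).comp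
      ((tendsto_add_atTop_nat 1).comp hφ.tendsto_atTop) |>.congr fun n => by simp
  refine ⟨π, hπ, fun k hk => ?_⟩
  have hlim' := tendsto_pi_nhds.1 hlim
  have hev : ∀ᶠ n in atTop, ∃ q ∈ F k, ∀ j,
      |q j - sc (φ n) (t (φ n)) j| ≤ (Fintype.card K : ℝ) / ((φ n : ℝ) + 1) := by
    filter_upwards [hsmall.eventually_lt (hlim' k) hk] with n hn
    have hpos : (0 : ℝ) < (φ n : ℝ) + 1 := by positivity
    rcases ht (φ n) k with h | ⟨t', ht', hck, hj⟩
    · exfalso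
      simp only [Function.comp, sc] at hn
      rw [div_lt_div_iff_of_pos_right hpos] at hn
      exact absurd h (not_le.2 (by exact_mod_cast hn))
    · refine ⟨sc (φ n) t', hck ▸ hcol _ (hsc _ _ ht'), fun j => ?_⟩
      simp only [sc]
      rw [← sub_div, abs_div, abs_of_pos hpos]
      gcongr
      have h1 : (t' j : ℝ) ≤ t (φ n) j + Fintype.card K := by exact_mod_cast (hj j).1
      have h2 : (t (φ n) j : ℝ) ≤ t' j + Fintype.card K := by exact_mod_cast (hj j).2
      rw [abs_le]
      constructor <;> linarith
  have hev' : ∀ n, ∃ q : K → ℝ, (∃ q ∈ F k, ∀ j,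
      |q j - sc (φ n) (t (φ n)) j| ≤ (Fintype.card K : ℝ) / ((φ n : ℝ) + 1)) → q ∈ F k ∧ ∀ j,
      |q j - sc (φ n) (t (φ n)) j| ≤ (Fintype.card K : ℝ) / ((φ n : ℝ) + 1) := by
    intro n
    by_cases h : ∃ q ∈ F k, ∀ j,
      |q j - sc (φ n) (t (φ n)) j| ≤ (Fintype.card K : ℝ) / ((φ n : ℝ) + 1)
    · obtain ⟨q, hq⟩ := h
      exact ⟨q, fun _ => hq⟩
    · exact ⟨0, fun h' => absurd h' h⟩
  choose q hq using hev'
  have hqF : ∀ᶠ n in atTop, q n ∈ F k := hev.mono fun n hn => (hq n hn).1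
  refine (hF k).mem_of_tendsto (f := q) ?_ hqF
  rw [tendsto_pi_nhds]
  intro j
  have hdiff : Tendsto (fun n => q n j - sc (φ n) (t (φ n)) j) atTop (𝓝 0) :=
    squeeze_zero_norm' (hev.mono fun n hn => by
      rw [Real.norm_eq_abs]; exact (hq n hn).2 j) hsmall
  simpa using hdiff.add (hlim' j)

open Filter Topology in
/-- Approximate solution of a variational inequality on the simplex for a possibly discontinuous
selection `h`, obtained by smoothing `h` with a partition of unity. -/
theorem exists_mem_convexHull_image_ball {K E : Type*} [Fintype K] [Nonempty K]
    [AddCommGroup E] [Module ℝ E] [TopologicalSpace E] [ContinuousAdd E] [ContinuousSMul ℝ E]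
    (h : (K → ℝ) → E) {G : E → K → ℝ} (hG : Continuous G) {ε : ℝ} (hε : 0 < ε) :
    ∃ π ∈ stdSimplex ℝ K, ∃ y ∈ convexHull ℝ (h '' (stdSimplex ℝ K ∩ Metric.ball π ε)),
      ∀ k, 0 < π k → ∀ j, G y j ≤ G y k := by
  classical
  obtain ⟨s, hsΔ, hsfin, hs⟩ := (isCompact_stdSimplex ℝ K).finite_cover_balls hε
  set S := hsfin.toFinset with hS
  let w : (K → ℝ) → (K → ℝ) → ℝ := fun π x => max 0 (ε - dist x π)
  have hw0 : ∀ π x, 0 ≤ w π x := fun π x => le_max_left _ _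
  have hwc : ∀ x, Continuous fun π => w π x := fun x => by
    simp only [w]; fun_prop
  have hwpos : ∀ π ∈ stdSimplex ℝ K, 0 < ∑ x ∈ S, w π x := by
    intro π hπ
    obtain ⟨x, hx, hxπ⟩ := Set.mem_iUnion₂.1 (hs hπ)
    refine sum_pos' (fun x _ => hw0 π x) ⟨x, hsfin.mem_toFinset.2 hx, ?_⟩
    rw [Metric.mem_ball, dist_comm] at hxπ
    exact lt_max_of_lt_right (by linarith)
  let y : (K → ℝ) → E := fun π => S.centerMass (w π) h
  have hyc : ContinuousOn y (stdSimplex ℝ K) := by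
    simp only [y, Finset.centerMass]
    refine ContinuousOn.smul (ContinuousOn.inv₀ ?_ fun π hπ => (hwpos π hπ).ne') ?_
    · exact (continuous_finsetSum _ fun x _ => hwc x).continuousOn
    · exact (continuous_finsetSum _ fun x _ => (hwc x).smul continuous_const).continuousOn
  have hGy : ∀ k, ContinuousOn (fun π => G (y π) k) (stdSimplex ℝ K) := fun k =>
    ((continuous_apply k).comp hG).comp_continuousOn hyc
  obtain ⟨π, hπ, hπF⟩ := exists_mem_of_stdSimplex_subset_iUnion
    (F := fun k => ⋂ j, {π ∈ stdSimplex ℝ K | G (y π) j ≤ G (y π) k})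
    (fun k => isClosed_iInter fun j =>
      (isClosed_stdSimplex ℝ K).isClosed_le (hGy j) (hGy k))
    (by
      intro π hπ
      obtain ⟨k, -, hk⟩ := exists_max_image univ (G (y π)) univ_nonempty
      exact Set.mem_iUnion.2 ⟨k, Set.mem_iInter.2 fun j => ⟨hπ, hk j (mem_univ j)⟩⟩)
  refine ⟨π, hπ, y π, ?_, fun k hk j => (Set.mem_iInter.1 (hπF k hk) j).2⟩
  simp only [y]
  rw [← centerMass_filter_ne_zero]
  refine centerMass_mem_convexHull _ (fun x _ => hw0 π x) ?_ ?_
  · rw [sum_filter_ne_zero]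
    exact hwpos π hπ
  · intro x hx
    rw [mem_filter] at hx
    refine ⟨x, ⟨hsΔ (hsfin.mem_toFinset.1 hx.1), ?_⟩, rfl⟩
    rw [Metric.mem_ball]
    by_contra! hd
    exact hx.2 (max_eq_left (by linarith))

open Filter Topology in
/-- Exact solution of a variational inequality on the simplex for a possibly discontinuous
selection `h`; the solution `y` replaces the value `h π` by a limit of convex combinations of
values of `h` near `π`. -/
theorem exists_variational_solution {K E : Type*} [Fintype K] [Nonempty K]
    [NormedAddCommGroup E] [NormedSpace ℝ E] {A : Set E} (hA : IsCompact A) (hAcvx : Convex ℝ A)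
    {h : (K → ℝ) → E} (hhA : ∀ π ∈ stdSimplex ℝ K, h π ∈ A) {G : E → K → ℝ} (hG : Continuous G) :
    ∃ π ∈ stdSimplex ℝ K, ∃ y : E, (∀ k, 0 < π k → ∀ j, G y j ≤ G y k) ∧
      ∀ B : Set E, IsClosed B → Convex ℝ B → (∀ᶠ ρ in 𝓝[stdSimplex ℝ K] π, h ρ ∈ B) → y ∈ B := by
  choose π hπ y hy hvar using fun n : ℕ =>
    exists_mem_convexHull_image_ball h hG (Nat.one_div_pos_of_nat (α := ℝ) (n := n))
  have hyA : ∀ n, y n ∈ A := fun n =>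
    convexHull_min (Set.image_subset_iff.2 fun ρ hρ => hhA ρ hρ.1) hAcvx (hy n)
  obtain ⟨⟨π', y'⟩, hmem, φ, hφ, hlim⟩ := ((isCompact_stdSimplex ℝ K).prod hA).tendsto_subseq
    (x := fun n => (π n, y n)) (fun n => ⟨hπ n, hyA n⟩)
  have hlimπ : Tendsto (fun n => π (φ n)) atTop (𝓝 π') := (continuous_fst.tendsto _).comp hlim
  have hlimy : Tendsto (fun n => y (φ n)) atTop (𝓝 y') := (continuous_snd.tendsto _).comp hlim
  have hlimG : ∀ k, Tendsto (fun n => G (y (φ n)) k) atTop (𝓝 (G y' k)) := fun k =>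
    (((continuous_apply k).comp hG).tendsto _).comp hlimy
  refine ⟨π', hmem.1, y', fun k hk j => ?_, fun B hB hBcvx hev => ?_⟩
  · refine le_of_tendsto_of_tendsto (hlimG j) (hlimG k) ?_
    filter_upwards [(tendsto_pi_nhds.1 hlimπ k).eventually (lt_mem_nhds hk)] with n hn
    exact hvar (φ n) k hn j
  · obtain ⟨δ, hδ, hball⟩ := Metric.mem_nhdsWithin_iff.1 hev
    refine hB.mem_of_tendsto hlimy ?_
    have h1 : Tendsto (fun n => (1 : ℝ) / ((φ n : ℝ) + 1)) atTop (𝓝 0) :=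
      tendsto_one_div_add_atTop_nhds_zero_nat.comp hφ.tendsto_atTop
    filter_upwards [h1.eventually (gt_mem_nhds (half_pos hδ)),
      hlimπ.eventually (Metric.ball_mem_nhds π' (half_pos hδ))] with n hn1 hn2
    refine convexHull_min ?_ hBcvx (hy (φ n))
    rintro _ ⟨ρ, ⟨hρ, hρb⟩, rfl⟩
    refine hball ⟨?_, hρ⟩
    rw [Metric.mem_ball] at hρb ⊢
    linarith [dist_triangle ρ (π (φ n)) π']

/-- `z` maximizes `u` over the bundles in `X` that cost at most `m` at prices `q`. -/
def IsDemand {O : Type*} [Fintype O] (u : (O → ℝ) → ℝ) (X : Set (O → ℝ)) (q : O → ℝ) (m : ℝ)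
    (z : O → ℝ) : Prop :=
  z ∈ X ∧ dotO q z ≤ m ∧ ∀ w ∈ X, dotO q w ≤ m → u w ≤ u z

theorem continuous_dotO {Y O : Type*} [TopologicalSpace Y] [Fintype O] {f g : Y → O → ℝ}
    (hf : Continuous f) (hg : Continuous g) : Continuous fun y => dotO (f y) (g y) :=
  continuous_finsetSum _ fun l _ =>
    ((continuous_apply l).comp hf).mul ((continuous_apply l).comp hg)

theorem dotO_smul {O : Type*} [Fintype O] (q z : O → ℝ) (t : ℝ) :
    dotO q (t • z) = t * dotO q z := by
  simp only [dotO, Pi.smul_apply, smul_eq_mul, mul_sum]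
  exact sum_congr rfl fun l _ => by ring

theorem dotO_add {O : Type*} [Fintype O] (q z w : O → ℝ) :
    dotO q (z + w) = dotO q z + dotO q w := by
  simp only [dotO, Pi.add_apply, mul_add, sum_add_distrib]

theorem dotO_nonneg {O : Type*} [Fintype O] {q z : O → ℝ} (hq : ∀ l, 0 ≤ q l)
    (hz : ∀ l, 0 ≤ z l) : 0 ≤ dotO q z :=
  sum_nonneg fun l _ => mul_nonneg (hq l) (hz l)

theorem dotO_mono {O : Type*} [Fintype O] {q z w : O → ℝ} (hq : ∀ l, 0 ≤ q l)
    (hzw : ∀ l, z l ≤ w l) : dotO q z ≤ dotO q w :=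
  sum_le_sum fun l _ => mul_le_mul_of_nonneg_left (hzw l) (hq l)

theorem pers_nonneg {I O C : Type*} [Fintype C] {a : C → I → O → ℝ} (ha : ∀ c i l, 0 ≤ a c i l)
    {p : C → ℝ} (hp : ∀ c, 0 ≤ p c) (i : I) (l : O) : 0 ≤ pers a p i l :=
  sum_nonneg fun c _ => mul_nonneg (ha c i l) (hp c)

theorem sum_dotO_pers {I O C : Type*} [Fintype I] [Fintype O] [Fintype C] (a : C → I → O → ℝ)
    (p : C → ℝ) (x : I → O → ℝ) :
    ∑ i, dotO (pers a p i) (x i) = ∑ c, p c * dotIO (a c) x := by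
  simp only [dotO, pers, dotIO, sum_mul, mul_sum]
  rw [sum_congr rfl fun i _ => sum_comm, sum_comm]
  exact sum_congr rfl fun c _ => sum_congr rfl fun i _ => sum_congr rfl fun l _ => by ring

theorem exists_isDemand {O : Type*} [Fintype O] {u : (O → ℝ) → ℝ} {X : Set (O → ℝ)}
    (hX : IsCompact X) (h0 : (0 : O → ℝ) ∈ X) (hu : ContinuousOn u X) (q : O → ℝ) {m : ℝ}
    (hm : 0 ≤ m) : ∃ z, IsDemand u X q m z := by
  have hcl : IsClosed {z | dotO q z ≤ m} :=
    isClosed_le (continuous_dotO continuous_const continuous_id) continuous_const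
  obtain ⟨z, hz, hmax⟩ := (hX.inter_right hcl).exists_isMaxOn
    ⟨0, h0, by simpa [dotO] using hm⟩ (hu.mono Set.inter_subset_left)
  exact ⟨z, hz.1, hz.2, fun w hw hwm => hmax ⟨hw, hwm⟩⟩

open Filter Topology in
/-- Demand is stable under limits of convex combinations of demands at nearby parameters, as long as
income is positive. -/
theorem isDemand_of_limit {P O : Type*} [TopologicalSpace P] [Fintype O] {u : (O → ℝ) → ℝ}
    {X : Set (O → ℝ)} (hX : IsCompact X) (hXcvx : Convex ℝ X) (h0 : (0 : O → ℝ) ∈ X)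
    (hu : ContinuousOn u X) (huq : QuasiconcaveOn ℝ X u) {Δ : Set P} {Q : P → O → ℝ}
    (hQ : Continuous Q) {m : P → ℝ} (hm : Continuous m) {h : P → O → ℝ}
    (hh : ∀ ρ ∈ Δ, IsDemand u X (Q ρ) (m ρ) (h ρ)) {π : P} (hmpos : 0 < m π) {y : O → ℝ}
    (hy : ∀ B : Set (O → ℝ), IsClosed B → Convex ℝ B → (∀ᶠ ρ in 𝓝[Δ] π, h ρ ∈ B) → y ∈ B) :
    IsDemand u X (Q π) (m π) y := by
  have hev : ∀ᶠ ρ in 𝓝[Δ] π, IsDemand u X (Q ρ) (m ρ) (h ρ) :=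
    mem_of_superset self_mem_nhdsWithin hh
  have hyX : y ∈ X := hy X hX.isClosed hXcvx (hev.mono fun ρ hρ => hρ.1)
  refine ⟨hyX, le_of_forall_pos_le_add fun δ hδ => ?_, ?_⟩
  · refine hy {z | dotO (Q π) z ≤ m π + δ}
      (isClosed_le (continuous_dotO continuous_const continuous_id) continuous_const) ?_ ?_
    · intro z hz w hw s t hs ht hst
      simp only [Set.mem_ofPred_eq, dotO_add, dotO_smul] at hz hw ⊢
      have h1 := mul_le_mul_of_nonneg_left hz hs
      have h2 := mul_le_mul_of_nonneg_left hw ht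
      have h3 : s * (m π + δ) + t * (m π + δ) = m π + δ := by rw [← add_mul, hst, one_mul]
      linarith
    · have hunif : ∀ᶠ ρ in 𝓝 π, ∀ z ∈ X, dotO (Q π) z < dotO (Q ρ) z - m ρ + m π + δ := by
        refine hX.eventually_forall_of_forall_eventually fun z _ => ?_
        have h1 : Continuous fun v : P × (O → ℝ) => dotO (Q π) v.2 :=
          continuous_dotO continuous_const continuous_snd
        have h2 : Continuous fun v : P × (O → ℝ) => dotO (Q v.1) v.2 - m v.1 + m π + δ :=
          (((continuous_dotO (hQ.comp continuous_fst) continuous_snd).sub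
            (hm.comp continuous_fst)).add continuous_const).add continuous_const
        exact (h1.tendsto (π, z)).eventually_lt (h2.tendsto (π, z)) (by simpa using hδ)
      filter_upwards [hev, hunif.filter_mono nhdsWithin_le_nhds] with ρ h1 h2
      have := h2 _ h1.1
      have := h1.2.1
      exact (by linarith : dotO (Q π) (h ρ) ≤ m π + δ)
  · have hstrict : ∀ z ∈ X, dotO (Q π) z < m π → u z ≤ u y := by
      intro z hz hzm
      refine (hy {w ∈ X | u z ≤ u w} ?_ (huq (u z)) ?_).2
      · exact hu.preimage_isClosed_of_isClosed hX.isClosed isClosed_Ici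
      · have : ∀ᶠ ρ in 𝓝 π, dotO (Q ρ) z < m ρ :=
          ((continuous_dotO hQ continuous_const).tendsto π).eventually_lt (hm.tendsto π) hzm
        filter_upwards [hev, this.filter_mono nhdsWithin_le_nhds] with ρ h1 h2
        exact ⟨h1.1, h1.2.2 z hz h2.le⟩
    intro z hz hzm
    have htX : ∀ t ∈ Set.Ioo (0 : ℝ) 1, t • z ∈ X := fun t ht =>
      hXcvx.smul_mem_of_zero_mem h0 hz ⟨ht.1.le, ht.2.le⟩
    have hIoo : ∀ᶠ t in 𝓝[<] (1 : ℝ), t ∈ Set.Ioo (0 : ℝ) 1 := Ioo_mem_nhdsLT zero_lt_one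
    have hlim : Tendsto (fun t : ℝ => t • z) (𝓝[<] 1) (𝓝[X] z) := by
      refine tendsto_nhdsWithin_iff.2 ⟨?_, hIoo.mono htX⟩
      have : Tendsto (fun t : ℝ => t • z) (𝓝 1) (𝓝 ((1 : ℝ) • z)) :=
        (continuous_id.smul continuous_const).tendsto 1
      rw [one_smul] at this
      exact this.mono_left nhdsWithin_le_nhds
    refine le_of_tendsto ((hu z hz).tendsto.comp hlim) ?_
    filter_upwards [hIoo] with t ht
    refine hstrict _ (htX t ht) ?_
    rw [dotO_smul]
    rcases le_or_gt (dotO (Q π) z) 0 with h' | h'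
    · exact (mul_nonpos_of_nonneg_of_nonpos ht.1.le h').trans_lt hmpos
    · exact (mul_lt_of_lt_one_left h' ht.2).trans_le hzm

theorem statement4 {I O C : Type*} [Fintype I] [Fintype O] [Fintype C]
    [Nonempty I] [Nonempty O]
    (S : Finset (I → O → ℝ)) (hSne : S.Nonempty)
    (𝒞 : Set (I → O → ℝ)) (h𝒞 : 𝒞 = convexHull ℝ (S : Set (I → O → ℝ)))
    (h𝒞nn : ∀ x ∈ 𝒞, ∀ i l, 0 ≤ x i l)
    (X : I → Set (O → ℝ))
    (hXnn : ∀ i, ∀ z ∈ X i, ∀ l, 0 ≤ z l)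
    (hXcpt : ∀ i, IsCompact (X i))
    (hXcvx : ∀ i, Convex ℝ (X i))
    (hX0 : ∀ i, (0 : O → ℝ) ∈ X i)
    (hXdc : ∀ i, ∀ y z : O → ℝ, (∀ l, 0 ≤ y l) → (∀ l, y l ≤ z l) → z ∈ X i → y ∈ X i)
    (a : C → I → O → ℝ) (b : C → ℝ)
    (ha : ∀ c i l, 0 ≤ a c i l) (hb : ∀ c, 0 < b c)
    (hlcs : {x : I → O → ℝ | (∀ i l, 0 ≤ x i l) ∧ ∃ x' ∈ 𝒞, ∀ i l, x i l ≤ x' i l}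
      = {x : I → O → ℝ | (∀ i l, 0 ≤ x i l) ∧ (∀ i, x i ∈ X i) ∧ ∀ c, dotIO (a c) x ≤ b c})
    (u : I → (O → ℝ) → ℝ)
    (hu_cont : ∀ i, ContinuousOn (u i) {z : O → ℝ | ∀ l, 0 ≤ z l})
    (hu_qc : ∀ i, ∀ z ∈ {z : O → ℝ | ∀ l, 0 ≤ z l}, ∀ w ∈ {z : O → ℝ | ∀ l, 0 ≤ z l},
      ∀ t : ℝ, 0 ≤ t → t ≤ 1 → min (u i z) (u i w) ≤ u i (t • z + (1 - t) • w))
    (hu_mono : ∀ i, ∀ z ∈ {z : O → ℝ | ∀ l, 0 ≤ z l}, ∀ w ∈ {z : O → ℝ | ∀ l, 0 ≤ z l},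
      (∀ l, w l ≤ z l) → w ≠ z → u i w < u i z)
    (ω : I → O → ℝ) (hωX : ∀ i, ω i ∈ X i) (hω𝒞 : ω ∈ 𝒞)
    (hωc : ∀ c, 0 < dotIO (a c) ω)
    (α : ℝ) (hα0 : 0 < α) (hα1 : α ≤ 1) :
    ∃ (x : I → O → ℝ) (p : C → ℝ),
      (∀ c, 0 ≤ p c) ∧
      (∀ i, x i ∈ X i ∧ dotO (pers a p i) (x i) ≤ α + (1 - α) * dotO (pers a p i) (ω i) ∧
        ∀ z ∈ X i, dotO (pers a p i) z ≤ α + (1 - α) * dotO (pers a p i) (ω i) → u i z ≤ u i (x i)) ∧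
      x ∈ 𝒞 ∧
      (∀ c, dotIO (a c) x < b c → p c = 0) ∧
      (¬ ∃ y ∈ 𝒞, ∀ i, u i (x i) < u i (y i)) := by
  classical
  have hlcs' : ∀ x ∈ 𝒞, (∀ i, x i ∈ X i) ∧ ∀ c, dotIO (a c) x ≤ b c := by
    intro x hx
    have : x ∈ {x : I → O → ℝ | (∀ i l, 0 ≤ x i l) ∧ ∃ x' ∈ 𝒞, ∀ i l, x i l ≤ x' i l} :=
      ⟨h𝒞nn x hx, x, hx, fun _ _ => le_rfl⟩
    rw [hlcs] at this
    exact this.2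
  have huX : ∀ i, ContinuousOn (u i) (X i) := fun i => (hu_cont i).mono (hXnn i)
  have huq : ∀ i, QuasiconcaveOn ℝ (X i) (u i) := by
    intro i v z hz w hw s t hs ht hst
    refine ⟨hXcvx i hz.1 hw.1 hs ht hst, ?_⟩
    have := hu_qc i z (hXnn i z hz.1) w (hXnn i w hw.1) s hs (by linarith)
    rw [show 1 - s = t by linarith] at this
    exact (le_min hz.2 hw.2).trans this
  obtain ⟨n, hn⟩ : ∃ n : ℝ, n = (Fintype.card I : ℝ) := ⟨_, rfl⟩
  have hn0 : 0 ≤ n := hn ▸ Nat.cast_nonneg _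
  let p : (Option C → ℝ) → C → ℝ := fun π c => (n + 1) * π (some c) / b c
  have hp0 : ∀ π ∈ stdSimplex ℝ (Option C), ∀ c, 0 ≤ p π c := fun π hπ c =>
    div_nonneg (mul_nonneg (by linarith) (hπ.1 _)) (hb c).le
  let m : I → (Option C → ℝ) → ℝ := fun i π => α + (1 - α) * dotO (pers a (p π) i) (ω i)
  have hm0 : ∀ i, ∀ π ∈ stdSimplex ℝ (Option C), 0 < m i π := fun i π hπ =>
    add_pos_of_pos_of_nonneg hα0 (mul_nonneg (by linarith)
      (dotO_nonneg (pers_nonneg ha (hp0 π hπ) i) (hXnn i _ (hωX i))))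
  have hQ : ∀ i, Continuous fun π => pers a (p π) i := by
    refine fun i => continuous_pi fun l => ?_
    simp only [pers, p]
    fun_prop
  have hmc : ∀ i, Continuous (m i) := fun i =>
    continuous_const.add (continuous_const.mul (continuous_dotO (hQ i) continuous_const))
  have hdem : ∀ π : Option C → ℝ, ∃ d : I → O → ℝ, π ∈ stdSimplex ℝ (Option C) →
      ∀ i, IsDemand (u i) (X i) (pers a (p π) i) (m i π) (d i) := by
    intro π
    by_cases hπ : π ∈ stdSimplex ℝ (Option C)
    · choose d hd using fun i => exists_isDemand (hXcpt i) (hX0 i) (huX i) (pers a (p π) i)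
        (hm0 i π hπ).le
      exact ⟨d, fun _ => hd⟩
    · exact ⟨0, fun h => absurd h hπ⟩
  choose h hh using hdem
  let G : (I → O → ℝ) → Option C → ℝ := fun x k => k.elim 0 fun c => (dotIO (a c) x - b c) / b c
  have hG : Continuous G := by
    refine continuous_pi fun k => ?_
    rcases k with _ | c
    · exact continuous_const
    · simp only [G, Option.elim, dotIO]
      fun_prop
  obtain ⟨π, hπ, x, hvar, hlim⟩ := exists_variational_solution
    (A := Set.univ.pi X) (isCompact_univ_pi hXcpt) (convex_pi fun i _ => hXcvx i)
    (h := h) (fun π hπ i _ => (hh π hπ i).1) hG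
  have hx : ∀ i, IsDemand (u i) (X i) (pers a (p π) i) (m i π) (x i) := by
    intro i
    refine isDemand_of_limit (hXcpt i) (hXcvx i) (hX0 i) (huX i) (huq i) (hQ i) (hmc i)
      (h := fun ρ => h ρ i) (fun ρ hρ => hh ρ hρ i) (hm0 i π hπ) fun B hB hBc hev => ?_
    exact hlim ((fun z : I → O → ℝ => z i) ⁻¹' B) (hB.preimage (continuous_apply i))
      (hBc.linear_preimage (LinearMap.proj (R := ℝ) (φ := fun _ : I => O → ℝ) i)) hev
  have hp := hp0 π hπ
  have hpersnn := pers_nonneg ha hp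
  have hbudget : ∑ c, p π c * dotIO (a c) x ≤ α * n + (1 - α) * ∑ c, p π c * b c := by
    have h1 : ∑ i, dotO (pers a (p π) i) (x i) ≤ ∑ i, m i π := sum_le_sum fun i _ => (hx i).2.1
    have h2 : ∑ c, p π c * dotIO (a c) ω ≤ ∑ c, p π c * b c :=
      sum_le_sum fun c _ => mul_le_mul_of_nonneg_left ((hlcs' ω hω𝒞).2 c) (hp c)
    have h3 : ∑ i, m i π = α * n + (1 - α) * ∑ c, p π c * dotIO (a c) ω := by
      simp only [m]
      rw [sum_add_distrib, ← mul_sum, sum_dotO_pers]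
      simp [hn, mul_comm]
    rw [sum_dotO_pers, h3] at h1
    have h4 := mul_le_mul_of_nonneg_left h2 (show 0 ≤ 1 - α by linarith)
    linarith
  have hfeas : ∀ c, dotIO (a c) x ≤ b c := by
    by_contra! hcon
    obtain ⟨c₀, hc₀⟩ := hcon
    have hpos : 0 < G x (some c₀) := div_pos (by linarith) (hb c₀)
    have hnone : π none = 0 := by
      by_contra hne
      have : G x (some c₀) ≤ G x none := hvar none (lt_of_le_of_ne (hπ.1 _) (Ne.symm hne)) _
      simp only [G, Option.elim] at this hpos
      linarith
    have hsum : ∑ c, p π c * b c = n + 1 := by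
      have h1 := hπ.2
      rw [Fintype.sum_option, hnone, zero_add] at h1
      calc ∑ c, p π c * b c = ∑ c, (n + 1) * π (some c) :=
            sum_congr rfl fun c _ => div_mul_cancel₀ _ (hb c).ne'
        _ = n + 1 := by rw [← mul_sum, h1, mul_one]
    have hge : ∑ c, p π c * b c ≤ ∑ c, p π c * dotIO (a c) x := by
      refine sum_le_sum fun c _ => ?_
      rcases (hπ.1 (some c)).eq_or_lt with h0 | h0
      · simp [p, ← h0]
      · have h1 := hpos.trans_le (hvar (some c) h0 (some c₀))
        simp only [G, Option.elim] at h1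
        have h2 := (div_pos_iff_of_pos_right (hb c)).1 h1
        exact mul_le_mul_of_nonneg_left (by linarith) (hp c)
    rw [hsum] at hge hbudget
    nlinarith
  have hcomp : ∀ c, dotIO (a c) x < b c → p π c = 0 := by
    intro c hc
    have h0 : π (some c) = 0 := by
      by_contra hne
      have h1 : G x none ≤ G x (some c) :=
        hvar (some c) (lt_of_le_of_ne (hπ.1 _) (Ne.symm hne)) none
      have h2 : G x (some c) < 0 := div_neg_of_neg_of_pos (by linarith) (hb c)
      simp only [G, Option.elim] at h1 h2
      linarith
    simp [p, h0]
  have hvalue : ∑ i, dotO (pers a (p π) i) (x i) = ∑ c, p π c * b c := by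
    rw [sum_dotO_pers]
    refine sum_congr rfl fun c _ => ?_
    rcases (hfeas c).eq_or_lt with h1 | h1
    · rw [h1]
    · rw [hcomp c h1, zero_mul, zero_mul]
  have hle : ∀ y ∈ 𝒞, ∑ i, dotO (pers a (p π) i) (y i) ≤ ∑ i, dotO (pers a (p π) i) (x i) := by
    intro y hy
    rw [hvalue, sum_dotO_pers]
    exact sum_le_sum fun c _ => mul_le_mul_of_nonneg_left ((hlcs' y hy).2 c) (hp c)
  have hexp : ∀ y ∈ 𝒞, ∀ i, u i (x i) < u i (y i) →
      dotO (pers a (p π) i) (x i) < dotO (pers a (p π) i) (y i) := by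
    intro y hy i hi
    refine (hx i).2.1.trans_lt (not_le.1 fun hcon => ?_)
    exact absurd ((hx i).2.2 (y i) ((hlcs' y hy).1 i) hcon) (not_le.2 hi)
  have hx𝒞 : x ∈ 𝒞 := by
    have hmem : x ∈ {x : I → O → ℝ | (∀ i l, 0 ≤ x i l) ∧ (∀ i, x i ∈ X i) ∧
        ∀ c, dotIO (a c) x ≤ b c} := ⟨fun i => hXnn i _ (hx i).1, fun i => (hx i).1, hfeas⟩
    rw [← hlcs] at hmem
    obtain ⟨hxnn, x', hx', hxx'⟩ := hmem
    have heq : x = x' := by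
      by_contra hne
      obtain ⟨i, hi⟩ := Function.ne_iff.1 hne
      have hlt := hexp x' hx' i (hu_mono i (x' i) (h𝒞nn x' hx' i) (x i) (hxnn i) (hxx' i) hi)
      have : ∑ i, dotO (pers a (p π) i) (x i) < ∑ i, dotO (pers a (p π) i) (x' i) :=
        sum_lt_sum (fun j _ => dotO_mono (hpersnn j) (hxx' j)) ⟨i, mem_univ i, hlt⟩
      exact absurd (hle x' hx') (not_le.2 this)
    exact heq ▸ hx'
  refine ⟨x, p π, hp, hx, hx𝒞, hcomp, ?_⟩
  rintro ⟨y, hy, hyu⟩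
  exact absurd (hle y hy) (not_le.2 (sum_lt_sum_of_nonempty univ_nonempty
    fun i _ => hexp y hy i (hyu i)))
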